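/- arXiv:2205.13309 — 3 statements merged into one kernel-verified Lean document; each statement's English description precedes it below -/
import Mathlib

section
/- For every d ≥ 4, the set of canonical vertices of the White Whale H_∞^+(d,1) that are sums of exactly 4 generators is {(0,…,0,1,3,3), (0,…,0,2,2,4), (0,…,0,1,1,1,4)}: a point v with nondecreasing coordinates is a vertex of H_∞^+(d,1) of the form p(S) with S ⊆ G_d and |S| = 4 if and only if v is one of these three points. -/
/-- The set `G_d` of generators of the White Whale:
all nonzero 0/1-valued vectors of `ℝ^d`. -/
def whaleGens (d : ℕ) : Set (Fin d → ℝ) :=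
  {g | g ≠ 0 ∧ ∀ i, g i = 0 ∨ g i = 1}

/-- The point `p(S)`: the sum of the vectors in `S` (with `p(∅) = 0`). -/
noncomputable def whaleSum {d : ℕ} (S : Set (Fin d → ℝ)) : Fin d → ℝ :=
  ∑ᶠ g ∈ S, g

/-- The White Whale `H_∞^+(d,1)`: the convex hull of the points `p(S)`
over all subsets `S ⊆ G_d`. -/
noncomputable def whiteWhale (d : ℕ) : Set (Fin d → ℝ) :=
  convexHull ℝ {x | ∃ S : Set (Fin d → ℝ), S ⊆ whaleGens d ∧ x = whaleSum S}

/-- A vertex of the White Whale is an extreme point of it. -/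
def IsWhaleVertex (d : ℕ) (x : Fin d → ℝ) : Prop :=
  x ∈ Set.extremePoints ℝ (whiteWhale d)

open Finset

section Families

variable {α : Type*} [DecidableEq α]

/-- The family `{x}, {y}, {x, y}, {x, y, n}`. -/
def pairFamily (x y n : α) : Finset (Finset α) := {{x}, {y}, {x, y}, {x, y, n}}

/-- The family of all subsets of `{x, a, b}` that contain `x`. -/
def squareFamily (x a b : α) : Finset (Finset α) := {{x}, {x, a}, {x, b}, {x, a, b}}

/-- The family `{x}, {x, a}, {x, b}, {x, c}`. -/
def starFamily (x a b c : α) : Finset (Finset α) := {{x}, {x, a}, {x, b}, {x, c}}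

theorem sum_insert_three {β M : Type*} [DecidableEq β] [AddCommMonoid M] {A B C D : β}
    (hAB : A ≠ B) (hAC : A ≠ C) (hAD : A ≠ D) (hBC : B ≠ C) (hBD : B ≠ D) (hCD : C ≠ D)
    (f : β → M) : ∑ E ∈ ({A, B, C, D} : Finset β), f E = f A + (f B + (f C + f D)) := by
  rw [sum_insert, sum_insert, sum_insert, sum_singleton] <;> simp [*]

theorem ne_of_notMem_of_mem {β : Type*} {A B : Finset β} (a : β) (hA : a ∉ A) (hB : a ∈ B) : A ≠ B :=
  fun h => hA (h ▸ hB)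

theorem sum_pairFamily {M : Type*} [AddCommMonoid M] {x y n : α} (hxy : x ≠ y) (hxn : x ≠ n)
    (hyn : y ≠ n) (f : Finset α → M) :
    ∑ A ∈ pairFamily x y n, f A = f {x} + (f {y} + (f {x, y} + f {x, y, n})) := by
  refine sum_insert_three (ne_of_notMem_of_mem y ?_ ?_) (ne_of_notMem_of_mem y ?_ ?_)
    (ne_of_notMem_of_mem y ?_ ?_) (ne_of_notMem_of_mem x ?_ ?_) (ne_of_notMem_of_mem x ?_ ?_)
    (ne_of_notMem_of_mem n ?_ ?_) f <;> grind

theorem sum_squareFamily {M : Type*} [AddCommMonoid M] {x a b : α} (hxa : x ≠ a) (hxb : x ≠ b)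
    (hab : a ≠ b) (f : Finset α → M) :
    ∑ A ∈ squareFamily x a b, f A = f {x} + (f {x, a} + (f {x, b} + f {x, a, b})) := by
  refine sum_insert_three (ne_of_notMem_of_mem a ?_ ?_) (ne_of_notMem_of_mem b ?_ ?_)
    (ne_of_notMem_of_mem a ?_ ?_) (ne_of_notMem_of_mem b ?_ ?_) (ne_of_notMem_of_mem b ?_ ?_)
    (ne_of_notMem_of_mem a ?_ ?_) f <;> grind

theorem sum_starFamily {M : Type*} [AddCommMonoid M] {x a b c : α} (hxa : x ≠ a) (hxb : x ≠ b)
    (hxc : x ≠ c) (hab : a ≠ b) (hac : a ≠ c) (hbc : b ≠ c) (f : Finset α → M) :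
    ∑ A ∈ starFamily x a b c, f A = f {x} + (f {x, a} + (f {x, b} + f {x, c})) := by
  refine sum_insert_three (ne_of_notMem_of_mem a ?_ ?_) (ne_of_notMem_of_mem b ?_ ?_)
    (ne_of_notMem_of_mem c ?_ ?_) (ne_of_notMem_of_mem b ?_ ?_) (ne_of_notMem_of_mem c ?_ ?_)
    (ne_of_notMem_of_mem c ?_ ?_) f <;> grind

theorem card_pairFamily {x y n : α} (hxy : x ≠ y) (hxn : x ≠ n) (hyn : y ≠ n) :
    #(pairFamily x y n) = 4 := by
  simp [card_eq_sum_ones, sum_pairFamily hxy hxn hyn]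

theorem card_squareFamily {x a b : α} (hxa : x ≠ a) (hxb : x ≠ b) (hab : a ≠ b) :
    #(squareFamily x a b) = 4 := by
  simp [card_eq_sum_ones, sum_squareFamily hxa hxb hab]

theorem card_starFamily {x a b c : α} (hxa : x ≠ a) (hxb : x ≠ b) (hxc : x ≠ c) (hab : a ≠ b)
    (hac : a ≠ c) (hbc : b ≠ c) : #(starFamily x a b c) = 4 := by
  simp [card_eq_sum_ones, sum_starFamily hxa hxb hxc hab hac hbc]

theorem empty_notMem_pairFamily {x y n : α} : ∅ ∉ pairFamily x y n := by
  simp [pairFamily, eq_comm (a := ∅)]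

theorem empty_notMem_squareFamily {x a b : α} : ∅ ∉ squareFamily x a b := by
  simp [squareFamily, eq_comm (a := ∅)]

theorem empty_notMem_starFamily {x a b c : α} : ∅ ∉ starFamily x a b c := by
  simp [starFamily, eq_comm (a := ∅)]

theorem exists_singleton_mem_of_mem {F : Finset (Finset α)} (h0 : ∅ ∉ F)
    (hD : ∀ A B : Finset α, A.Nonempty → B.Nonempty → Disjoint A B → A ∉ F → B ∉ F → A ∪ B ∉ F)
    {A : Finset α} (hA : A ∈ F) : ∃ x ∈ A, {x} ∈ F := by
  induction A using Finset.induction with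
  | empty => exact absurd hA h0
  | insert a B haB ih =>
    by_cases ha : {a} ∈ F
    · exact ⟨a, mem_insert_self _ _, ha⟩
    · rcases B.eq_empty_or_nonempty with rfl | hB
      · exact absurd hA ha
      · have hBF : B ∈ F := by
          by_contra hBF
          exact hD {a} B (singleton_nonempty a) hB (by simpa using haB) ha hBF
            (by rwa [← insert_eq])
        obtain ⟨x, hx, hxF⟩ := ih hBF
        exact ⟨x, mem_insert_of_mem hx, hxF⟩

theorem erase_mem_of_singleton_notMem {F : Finset (Finset α)}
    (hD : ∀ A B : Finset α, A.Nonempty → B.Nonempty → Disjoint A B → A ∉ F → B ∉ F → A ∪ B ∉ F)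
    {A : Finset α} (hA : A ∈ F) {n : α} (hn : n ∈ A) (hnF : {n} ∉ F) : A.erase n ∈ F := by
  by_contra h
  rcases (A.erase n).eq_empty_or_nonempty with he | he
  · rcases (erase_eq_empty_iff A n).1 he with rfl | rfl
    · simp at hn
    · exact hnF hA
  · refine hD {n} (A.erase n) (singleton_nonempty n) he (by simp) hnF h ?_
    rwa [← insert_eq, insert_erase hn]

theorem mem_of_mem_of_subset_of_star {F : Finset (Finset α)} {x : α}
    (hE : ∀ A ∈ F, ∀ n ∈ A, n ≠ x → A.erase n ∈ F) {A B : Finset α} (hA : A ∈ F)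
    (hxB : x ∈ B) (hBA : B ⊆ A) : B ∈ F := by
  induction A using Finset.strongInduction with
  | H A ih =>
    rcases hBA.eq_or_ssubset with rfl | hss
    · exact hA
    · obtain ⟨n, hnA, hnB⟩ := exists_of_ssubset hss
      have hnx : n ≠ x := fun h => hnB (h ▸ hxB)
      exact ih _ (erase_ssubset hnA) (hE A hA n hnA hnx) (subset_erase.2 ⟨hBA, hnB⟩)

/-- A family of four nonempty sets such that it and its complement are closed under disjoint
unions is one of three explicit families. -/
theorem eq_family_of_card_eq_four {F : Finset (Finset α)} (hF : #F = 4) (h0 : ∅ ∉ F)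
    (hU : ∀ A ∈ F, ∀ B ∈ F, Disjoint A B → A ∪ B ∈ F)
    (hD : ∀ A B : Finset α, A.Nonempty → B.Nonempty → Disjoint A B →
      A ∉ F → B ∉ F → A ∪ B ∉ F) :
    (∃ x y n, x ≠ y ∧ x ≠ n ∧ y ≠ n ∧ F = pairFamily x y n) ∨
    (∃ x a b, x ≠ a ∧ x ≠ b ∧ a ≠ b ∧ F = squareFamily x a b) ∨
    (∃ x a b c, x ≠ a ∧ x ≠ b ∧ x ≠ c ∧ a ≠ b ∧ a ≠ c ∧ b ≠ c ∧ F = starFamily x a b c) := by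
  obtain ⟨A₀, hA₀⟩ : F.Nonempty := card_pos.1 (by omega)
  obtain ⟨x, -, hx⟩ := exists_singleton_mem_of_mem h0 hD hA₀
  by_cases hy : ∃ y, y ≠ x ∧ {y} ∈ F
  · left
    obtain ⟨y, hyx, hy⟩ := hy
    have hxy : ({x, y} : Finset α) ∈ F := by
      have := hU _ hx _ hy (by simpa using hyx.symm)
      rwa [← insert_eq] at this
    have hc3 : #({{x}, {y}, {x, y}} : Finset (Finset α)) = 3 := by
      rw [card_eq_three]
      exact ⟨_, _, _, by simpa using hyx.symm, fun e => hyx (by simpa using Finset.ext_iff.1 e y),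
        fun e => hyx.symm (by simpa using Finset.ext_iff.1 e x), rfl⟩
    have hsub : ({{x}, {y}, {x, y}} : Finset (Finset α)) ⊆ F := by
      simp [insert_subset_iff, hx, hy, hxy]
    obtain ⟨h, hh⟩ := card_eq_one.1 (show #(F \ {{x}, {y}, {x, y}}) = 1 by
      rw [card_sdiff_of_subset hsub]; omega)
    have hmem : ∀ A, A ∈ F ↔ A = {x} ∨ A = {y} ∨ A = {x, y} ∨ A = h := by
      intro A
      have hA := Finset.ext_iff.1 hh A
      clear hU hD hF hh
      grind
    have hne : h ∈ F ∧ h ≠ {x} ∧ h ≠ {y} ∧ h ≠ {x, y} := by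
      have hA := Finset.ext_iff.1 hh h
      clear hU hD hF hh hmem
      grind
    obtain ⟨hhF, h1, h2, h3⟩ := hne
    have hx_mem : x ∈ h := by
      by_contra hn
      have hu := (hmem _).1 (hU _ hx _ hhF (by simpa using hn))
      rw [← insert_eq] at hu
      have hh : ∀ T, insert x h = T → h = T.erase x := by
        rintro _ rfl
        rw [erase_insert hn]
      rcases hu with e | e | e | e
      · exact h0 (by simpa [hh _ e] using hhF)
      · simpa [hyx.symm] using Finset.ext_iff.1 e x
      · exact h2 (by simpa [hyx.symm] using hh _ e)
      · exact hn (e ▸ mem_insert_self _ _)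
    have hy_mem : y ∈ h := by
      by_contra hn
      have hu := (hmem _).1 (hU _ hy _ hhF (by simpa using hn))
      rw [← insert_eq] at hu
      have hh : ∀ T, insert y h = T → h = T.erase y := by
        rintro _ rfl
        rw [erase_insert hn]
      rcases hu with e | e | e | e
      · simpa [hyx] using Finset.ext_iff.1 e y
      · exact h0 (by simpa [hh _ e] using hhF)
      · exact h1 (by simpa [pair_comm x y, hyx] using hh _ e)
      · exact hn (e ▸ mem_insert_self _ _)
    obtain ⟨n, hn, hnx, hny⟩ : ∃ n ∈ h, n ≠ x ∧ n ≠ y := by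
      by_contra! hcon
      clear hU hD hmem hh hF
      exact h3 (by grind)
    have hnF : {n} ∉ F := by
      rw [hmem]
      clear hU hD hmem hh hF
      grind
    have hEr := (hmem _).1 (erase_mem_of_singleton_notMem hD hhF hn hnF)
    have hh' : h = {x, y, n} := by
      clear hU hD hmem hh hF
      rcases hEr with e | e | e | e
      · grind
      · grind
      · rw [← insert_erase hn, e]
        ext
        simp only [mem_insert, mem_singleton]
        tauto
      · grind
    refine ⟨x, y, n, hyx.symm, hnx.symm, hny.symm, ?_⟩
    ext A
    simp [pairFamily, hmem, hh']
  · right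
    push Not at hy
    have hE : ∀ A ∈ F, ∀ n ∈ A, n ≠ x → A.erase n ∈ F := fun A hA n hn hnx =>
      erase_mem_of_singleton_notMem hD hA hn (hy n hnx)
    have hxm : ∀ A ∈ F, x ∈ A := by
      intro A hA
      obtain ⟨z, hz, hzF⟩ := exists_singleton_mem_of_mem h0 hD hA
      by_cases hzx : z = x
      · exact hzx ▸ hz
      · exact absurd hzF (hy z hzx)
    by_cases hbig : ∃ A ∈ F, ∃ a ∈ A, ∃ b ∈ A, x ≠ a ∧ x ≠ b ∧ a ≠ b
    · left
      obtain ⟨A, hA, a, ha, b, hb, hxa, hxb, hab⟩ := hbig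
      refine ⟨x, a, b, hxa, hxb, hab, (eq_of_subset_of_card_le ?_ ?_).symm⟩
      · intro B hB
        have hxA := hxm A hA
        refine mem_of_mem_of_subset_of_star hE hA ?_ ?_ <;>
        · simp only [squareFamily, mem_insert, mem_singleton] at hB
          rcases hB with rfl | rfl | rfl | rfl <;> simp [insert_subset_iff, *]
      · rw [hF, card_squareFamily hxa hxb hab]
    · right
      push Not at hbig
      have hform : ∀ A ∈ F, A ≠ {x} → ∃ a, x ≠ a ∧ A = {x, a} := by
        intro A hA hAx
        have hxA := hxm A hA
        obtain ⟨a, ha, hax⟩ : ∃ a ∈ A, x ≠ a := by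
          by_contra! hcon
          clear hU hD hE hF hbig
          exact hAx (by grind)
        have hbig' := hbig A hA a ha
        clear hU hD hE hF hbig
        exact ⟨a, hax, by grind⟩
      obtain ⟨A, B, C, hAB, hAC, hBC, hABC⟩ := card_eq_three.1
        (show #(F.erase {x}) = 3 by rw [card_erase_of_mem hx]; omega)
      have hmem : ∀ D, D ∈ F ∧ D ≠ {x} ↔ D = A ∨ D = B ∨ D = C := by
        intro D
        simpa [and_comm] using Finset.ext_iff.1 hABC D
      obtain ⟨a, hxa, rfl⟩ := hform A ((hmem A).2 (by simp)).1 ((hmem A).2 (by simp)).2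
      obtain ⟨b, hxb, rfl⟩ := hform B ((hmem B).2 (by simp)).1 ((hmem B).2 (by simp)).2
      obtain ⟨c, hxc, rfl⟩ := hform C ((hmem C).2 (by simp)).1 ((hmem C).2 (by simp)).2
      refine ⟨x, a, b, c, hxa, hxb, hxc, by rintro rfl; exact hAB rfl, by rintro rfl; exact hAC rfl,
        by rintro rfl; exact hBC rfl, ?_⟩
      rw [starFamily, ← hABC, insert_erase hx]

end Families

section Indicators

variable {d : ℕ}

/-- The 0/1-vector supported on `A`. -/
def indVec (A : Finset (Fin d)) : Fin d → ℝ := fun i => if i ∈ A then 1 else 0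

theorem indVec_injective : Function.Injective (indVec (d := d)) := by
  intro A B h
  ext i
  have := congrFun h i
  simp only [indVec] at this
  split_ifs at this <;> simp_all

theorem indVec_ne_zero {A : Finset (Fin d)} (hA : A.Nonempty) : indVec A ≠ 0 := by
  obtain ⟨i, hi⟩ := hA
  intro h
  have := congrFun h i
  simp [indVec, hi] at this

theorem indVec_union {A B : Finset (Fin d)} (h : Disjoint A B) :
    indVec (A ∪ B) = indVec A + indVec B := by
  ext i
  have hi := @(Finset.disjoint_left.mp h)
  specialize @hi i
  by_cases hA : i ∈ A <;> by_cases hB : i ∈ B <;> simp_all [indVec]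

theorem indVec_mem_whaleGens {A : Finset (Fin d)} (hA : A.Nonempty) : indVec A ∈ whaleGens d :=
  ⟨indVec_ne_zero hA, fun i => by by_cases h : i ∈ A <;> simp [indVec, h]⟩

theorem exists_indVec_eq {g : Fin d → ℝ} (hg : g ∈ whaleGens d) :
    ∃ A : Finset (Fin d), A.Nonempty ∧ indVec A = g := by
  classical
  have h : indVec (univ.filter fun i => g i = 1) = g := by
    ext i
    rcases hg.2 i with h | h <;> simp [indVec, h]
  refine ⟨_, ?_, h⟩
  rw [nonempty_iff_ne_empty]
  intro he
  rw [he] at h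
  exact hg.1 (h ▸ by ext i; simp [indVec])

theorem whaleSum_image (F : Finset (Finset (Fin d))) :
    whaleSum (indVec '' (F : Set (Finset (Fin d)))) = ∑ A ∈ F, indVec A := by
  rw [whaleSum, finsum_mem_image indVec_injective.injOn, finsum_mem_coe_finset]

theorem image_subset_whaleGens {F : Finset (Finset (Fin d))} (hF : ∅ ∉ F) :
    indVec '' (F : Set (Finset (Fin d))) ⊆ whaleGens d := by
  rintro _ ⟨A, hA, rfl⟩
  refine indVec_mem_whaleGens (nonempty_iff_ne_empty.2 ?_)
  rintro rfl
  exact hF hA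

theorem exists_family_of_subset_whaleGens {S : Set (Fin d → ℝ)} (hS : S ⊆ whaleGens d) :
    ∃ F : Finset (Finset (Fin d)), ∅ ∉ F ∧ S = indVec '' (F : Set (Finset (Fin d))) := by
  classical
  refine ⟨univ.filter fun A => indVec A ∈ S, ?_, ?_⟩
  · simp only [mem_filter, mem_univ, true_and]
    intro h
    exact (hS h).1 (by ext i; simp [indVec])
  · ext g
    constructor
    · intro hg
      obtain ⟨A, -, rfl⟩ := exists_indVec_eq (hS hg)
      exact ⟨A, by simpa using hg, rfl⟩
    · rintro ⟨A, hA, rfl⟩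
      simpa using hA

theorem sum_indVec_mem_whiteWhale {F : Finset (Finset (Fin d))} (hF : ∅ ∉ F) :
    ∑ A ∈ F, indVec A ∈ whiteWhale d :=
  subset_convexHull ℝ _ ⟨_, image_subset_whaleGens hF, (whaleSum_image F).symm⟩

theorem IsWhaleVertex.eq_zero_of_add_sub_mem {v w : Fin d → ℝ} (hv : IsWhaleVertex d v)
    (h₁ : v + w ∈ whiteWhale d) (h₂ : v - w ∈ whiteWhale d) : w = 0 := by
  have := (mem_extremePoints.1 hv).2 _ h₁ _ h₂
    ⟨1 / 2, 1 / 2, by norm_num, by norm_num, by norm_num, by ext i; simp; ring⟩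
  simpa using this.1

theorem IsWhaleVertex.union_mem {F : Finset (Finset (Fin d))} (h0 : ∅ ∉ F)
    (hv : IsWhaleVertex d (∑ A ∈ F, indVec A)) {A B : Finset (Fin d)} (hA : A ∈ F) (hB : B ∈ F)
    (hAB : Disjoint A B) : A ∪ B ∈ F := by
  by_contra hF
  have hAne : A.Nonempty := nonempty_iff_ne_empty.2 fun h => h0 (h ▸ hA)
  have hne : A ≠ B := by
    rintro rfl
    exact hAne.ne_empty (disjoint_self.1 hAB)
  refine indVec_ne_zero (hAne.mono subset_union_left) (hv.eq_zero_of_add_sub_mem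
    (w := indVec (A ∪ B)) ?_ ?_)
  · rw [add_comm, ← sum_insert hF]
    refine sum_indVec_mem_whiteWhale ?_
    simp only [mem_insert, not_or]
    exact ⟨(hAne.mono subset_union_left).ne_empty.symm, h0⟩
  · have h : ∑ C ∈ (F.erase A).erase B, indVec C = ∑ C ∈ F, indVec C - indVec (A ∪ B) := by
      rw [indVec_union hAB, ← add_sum_erase F _ hA,
        ← add_sum_erase (F.erase A) _ (mem_erase.2 ⟨hne.symm, hB⟩)]
      abel
    rw [← h]
    exact sum_indVec_mem_whiteWhale (by simp [h0])

theorem IsWhaleVertex.union_notMem {F : Finset (Finset (Fin d))} (h0 : ∅ ∉ F)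
    (hv : IsWhaleVertex d (∑ A ∈ F, indVec A)) {A B : Finset (Fin d)} (hAne : A.Nonempty)
    (hBne : B.Nonempty) (hAB : Disjoint A B) (hA : A ∉ F) (hB : B ∉ F) : A ∪ B ∉ F := by
  intro hF
  have hne : A ≠ B := by
    rintro rfl
    exact hAne.ne_empty (disjoint_self.1 hAB)
  refine indVec_ne_zero (hAne.mono subset_union_left) (hv.eq_zero_of_add_sub_mem
    (w := indVec (A ∪ B)) ?_ ?_)
  · have h : ∑ C ∈ insert A (insert B F), indVec C = ∑ C ∈ F, indVec C + indVec (A ∪ B) := by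
      rw [indVec_union hAB, sum_insert (by simp [hne, hA]), sum_insert hB]
      abel
    rw [← h]
    refine sum_indVec_mem_whiteWhale ?_
    simp [h0, hAne.ne_empty.symm, hBne.ne_empty.symm]
  · rw [← add_sum_erase F _ hF, add_sub_cancel_left]
    exact sum_indVec_mem_whiteWhale (by simp [h0])

theorem mem_extremePoints_convexHull_of_lt {E : Type*} [AddCommGroup E] [Module ℝ E]
    {X : Set E} {v : E} (hv : v ∈ X) (l : E →ₗ[ℝ] ℝ) (hl : ∀ x ∈ X, x ≠ v → l x < l v) :
    v ∈ Set.extremePoints ℝ (convexHull ℝ X) := by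
  rw [(convex_convexHull ℝ X).mem_extremePoints_iff_mem_sdiff_convexHull_sdiff]
  refine ⟨subset_convexHull ℝ X hv, fun h => ?_⟩
  have hsub : convexHull ℝ X ⊆ {x | l x < l v} ∪ {v} := by
    refine convexHull_min (fun x hx => ?_) ?_
    · by_cases hxv : x = v
      · exact Or.inr hxv
      · exact Or.inl (hl x hx hxv)
    · rintro x hx y hy a b ha hb hab
      have hle : ∀ z ∈ {x | l x < l v} ∪ {v}, l z ≤ l v := by
        rintro z (hz | rfl)
        · exact le_of_lt hz
        · exact le_rfl
      have hb' : b = 1 - a := by linarith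
      subst hb'
      have hlx := hle x hx
      have hly := hle y hy
      rcases ha.eq_or_lt with rfl | ha
      · simpa using hy
      rcases hb.eq_or_lt with hb0 | hb
      · have : a = 1 := by linarith
        subst this
        simpa using hx
      rcases hx with hx | rfl
      · left
        simp only [Set.mem_ofPred_eq, map_add, map_smul, smul_eq_mul] at hx ⊢
        nlinarith
      rcases hy with hy | rfl
      · left
        simp only [Set.mem_ofPred_eq, map_add, map_smul, smul_eq_mul] at hy ⊢
        nlinarith
      · right
        simp [← add_smul]
  have hconv : Convex ℝ {x | l x < l v} := convex_halfSpace_lt l.isLinear _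
  have : convexHull ℝ (convexHull ℝ X \ {v}) ⊆ {x | l x < l v} := by
    refine convexHull_min (fun x hx => ?_) hconv
    exact (hsub hx.1).resolve_right hx.2
  simpa using this h

/-- A family cut out by the strict sign of a weight function gives a vertex. -/
theorem isWhaleVertex_of_weight {F : Finset (Finset (Fin d))} (h0 : ∅ ∉ F) (c : Fin d → ℝ)
    (hpos : ∀ A ∈ F, 0 < ∑ i ∈ A, c i)
    (hneg : ∀ A : Finset (Fin d), A.Nonempty → A ∉ F → ∑ i ∈ A, c i < 0) :
    IsWhaleVertex d (∑ A ∈ F, indVec A) := by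
  set l : (Fin d → ℝ) →ₗ[ℝ] ℝ := ∑ i, c i • LinearMap.proj i with hl
  have hlA : ∀ A : Finset (Fin d), l (indVec A) = ∑ i ∈ A, c i := by
    intro A
    simp [hl, indVec]
  refine mem_extremePoints_convexHull_of_lt
    ⟨_, image_subset_whaleGens h0, (whaleSum_image F).symm⟩ l ?_
  rintro _ ⟨S, hS, rfl⟩ hne
  obtain ⟨F', h0', rfl⟩ := exists_family_of_subset_whaleGens hS
  rw [whaleSum_image] at hne ⊢
  simp only [map_sum, hlA]
  have hFF : F' ≠ F := fun h => hne (h ▸ rfl)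
  have hneg' : ∀ A ∈ F' \ F, ∑ i ∈ A, c i < 0 := by
    intro A hA
    rw [mem_sdiff] at hA
    exact hneg A (nonempty_iff_ne_empty.2 fun h => h0' (h ▸ hA.1)) hA.2
  have hpos' : ∀ A ∈ F \ F', 0 < ∑ i ∈ A, c i := fun A hA => hpos A (mem_sdiff.1 hA).1
  have e₁ := sum_sdiff_sub_sum_sdiff (s₁ := F') (s₂ := F) (f := fun A => ∑ i ∈ A, c i)
  by_cases hsub : F' ⊆ F
  · have hne' : (F \ F').Nonempty := by
      rw [sdiff_nonempty]
      exact fun h => hFF (hsub.antisymm h)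
    linarith [sum_pos hpos' hne', sum_nonpos fun A hA => (hneg' A hA).le]
  · linarith [sum_neg hneg' (sdiff_nonempty.2 hsub), sum_nonneg fun A hA => (hpos' A hA).le]

/-- To check the hypotheses of `isWhaleVertex_of_weight`, subsets of a fixed set `X` suffice when
all the coordinates outside `X` have a weight that is negative enough. -/
theorem isWhaleVertex_of_subset {F : Finset (Finset (Fin d))} (h0 : ∅ ∉ F) (X : Finset (Fin d))
    (c : Fin d → ℝ) (K : ℝ) (hout : ∀ i ∉ X, c i = -K)
    (hK : ∀ A ⊆ X, ∑ i ∈ A, c i < K)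
    (hpos : ∀ A ∈ F, 0 < ∑ i ∈ A, c i)
    (hneg : ∀ A ⊆ X, A.Nonempty → A ∉ F → ∑ i ∈ A, c i < 0) :
    IsWhaleVertex d (∑ A ∈ F, indVec A) := by
  refine isWhaleVertex_of_weight h0 c hpos fun A hA hAF => ?_
  by_cases hAX : A ⊆ X
  · exact hneg A hAX hA hAF
  · have hK0 : 0 < K := by simpa using hK ∅ (empty_subset X)
    obtain ⟨i, hi, hiX⟩ := not_subset.1 hAX
    rw [← sum_inter_add_sum_sdiff A X]
    have h₁ : ∑ j ∈ A \ X, c j ≤ ∑ j ∈ {i}, c j := by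
      refine sum_le_sum_of_subset_of_nonpos' (by simp [hi, hiX]) fun j hj _ => ?_
      rw [hout j (mem_sdiff.1 hj).2]
      linarith
    rw [sum_singleton, hout i hiX] at h₁
    linarith [hK (A ∩ X) inter_subset_right]

end Indicators

section Points

theorem eq_empty_or_eq_insert_of_subset_insert {α : Type*} [DecidableEq α] {A X : Finset α}
    {a : α} (h : A ⊆ insert a X) : A ⊆ X ∨ ∃ B ⊆ X, A = insert a B := by
  by_cases ha : a ∈ A
  · exact Or.inr ⟨A.erase a, subset_insert_iff.1 h, (insert_erase ha).symm⟩
  · exact Or.inl ((subset_insert_iff_of_notMem ha).1 h)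

theorem forall_subset_insert {α : Type*} [DecidableEq α] {X : Finset α} {a : α}
    {P : Finset α → Prop} :
    (∀ A ⊆ insert a X, P A) ↔ (∀ A ⊆ X, P A) ∧ ∀ A ⊆ X, P (insert a A) := by
  refine ⟨fun h => ⟨fun A hA => h A (hA.trans (subset_insert a X)),
    fun A hA => h _ (insert_subset_insert a hA)⟩, fun h A hA => ?_⟩
  rcases eq_empty_or_eq_insert_of_subset_insert hA with hA | ⟨B, hB, rfl⟩
  · exact h.1 A hA
  · exact h.2 B hB

variable {d : ℕ}

theorem isWhaleVertex_sum_pairFamily {x y n : Fin d} (hxy : x ≠ y) (hxn : x ≠ n) (hyn : y ≠ n) :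
    IsWhaleVertex d (∑ A ∈ pairFamily x y n, indVec A) := by
  refine isWhaleVertex_of_subset empty_notMem_pairFamily
    (insert x (insert y (insert n ∅)))
    (fun i => if i = x ∨ i = y then 2 else if i = n then -3 else -5) 5 ?_ ?_ ?_ ?_
  · intro i hi
    simp_all
  · simp only [forall_subset_insert, subset_empty, forall_eq]
    simp [hxy, hxn, hyn, hxy.symm, hxn.symm, hyn.symm]
    norm_num
  · simp [pairFamily, hxy, hxn, hyn, hxy.symm, hxn.symm, hyn.symm]
    norm_num
  · simp only [forall_subset_insert, subset_empty, forall_eq]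
    simp [pairFamily, hxy, hxn, hyn, hxy.symm, hxn.symm, hyn.symm]
    norm_num

theorem isWhaleVertex_sum_squareFamily {x a b : Fin d} (hxa : x ≠ a) (hxb : x ≠ b) (hab : a ≠ b) :
    IsWhaleVertex d (∑ A ∈ squareFamily x a b, indVec A) := by
  refine isWhaleVertex_of_subset empty_notMem_squareFamily
    (insert x (insert a (insert b ∅)))
    (fun i => if i = x then 3 else if i = a ∨ i = b then -1 else -4) 4 ?_ ?_ ?_ ?_
  · intro i hi
    simp_all
  · simp only [forall_subset_insert, subset_empty, forall_eq]
    simp [hxa, hxb, hab, hxa.symm, hxb.symm, hab.symm]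
    norm_num
  · simp [squareFamily, hxa, hxb, hab, hxa.symm, hxb.symm, hab.symm]
    norm_num
  · simp only [forall_subset_insert, subset_empty, forall_eq]
    simp [squareFamily, hxa, hxb, hab, hxa.symm, hxb.symm, hab.symm]

theorem isWhaleVertex_sum_starFamily {x a b c : Fin d} (hxa : x ≠ a) (hxb : x ≠ b) (hxc : x ≠ c)
    (hab : a ≠ b) (hac : a ≠ c) (hbc : b ≠ c) :
    IsWhaleVertex d (∑ A ∈ starFamily x a b c, indVec A) := by
  refine isWhaleVertex_of_subset empty_notMem_starFamily
    (insert x (insert a (insert b (insert c ∅))))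
    (fun i => if i = x then 3 else if i = a ∨ i = b ∨ i = c then -2 else -4) 4 ?_ ?_ ?_ ?_
  · intro i hi
    simp_all
  · simp only [forall_subset_insert, subset_empty, forall_eq]
    simp [hxa, hxb, hxc, hab, hac, hbc, hxa.symm, hxb.symm, hxc.symm,
      hab.symm, hac.symm, hbc.symm]
    norm_num
  · simp [starFamily, hxa, hxb, hxc, hab, hac, hbc, hxa.symm, hxb.symm, hxc.symm,
      hab.symm, hac.symm, hbc.symm]
    norm_num
  · simp only [forall_subset_insert, subset_empty, forall_eq]
    simp [starFamily, hxa, hxb, hxc, hab, hac, hbc, hxa.symm, hxb.symm, hxc.symm,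
      hab.symm, hac.symm, hbc.symm]
    norm_num

theorem sum_pairFamily_indVec {x y n : Fin d} (hxy : x ≠ y) (hxn : x ≠ n) (hyn : y ≠ n) :
    ∑ A ∈ pairFamily x y n, indVec A =
      fun i => if i = x ∨ i = y then 3 else if i = n then 1 else 0 := by
  rw [sum_pairFamily hxy hxn hyn]
  ext i
  by_cases h₁ : i = x <;> by_cases h₂ : i = y <;> by_cases h₃ : i = n <;>
    simp_all [indVec] <;> norm_num

theorem sum_squareFamily_indVec {x a b : Fin d} (hxa : x ≠ a) (hxb : x ≠ b) (hab : a ≠ b) :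
    ∑ A ∈ squareFamily x a b, indVec A =
      fun i => if i = x then 4 else if i = a ∨ i = b then 2 else 0 := by
  rw [sum_squareFamily hxa hxb hab]
  ext i
  by_cases h₁ : i = x <;> by_cases h₂ : i = a <;> by_cases h₃ : i = b <;>
    simp_all [indVec] <;> norm_num

theorem sum_starFamily_indVec {x a b c : Fin d} (hxa : x ≠ a) (hxb : x ≠ b) (hxc : x ≠ c)
    (hab : a ≠ b) (hac : a ≠ c) (hbc : b ≠ c) :
    ∑ A ∈ starFamily x a b c, indVec A =
      fun i => if i = x then 4 else if i = a ∨ i = b ∨ i = c then 1 else 0 := by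
  rw [sum_starFamily hxa hxb hxc hab hac hbc]
  ext i
  by_cases h₁ : i = x <;> by_cases h₂ : i = a <;> by_cases h₃ : i = b <;>
    by_cases h₄ : i = c <;> (simp_all [indVec]; try norm_num)

theorem injective_vecCons_three {α : Type*} {x y z : α} (hxy : x ≠ y) (hxz : x ≠ z)
    (hyz : y ≠ z) : Function.Injective ![x, y, z] := by
  simp [Function.Injective, Fin.forall_fin_succ, hxy, hxz, hyz, hxy.symm, hxz.symm, hyz.symm]

theorem injective_vecCons_four {α : Type*} {x a b c : α} (hxa : x ≠ a) (hxb : x ≠ b)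
    (hxc : x ≠ c) (hab : a ≠ b) (hac : a ≠ c) (hbc : b ≠ c) :
    Function.Injective ![x, a, b, c] := by
  simp [Function.Injective, Fin.forall_fin_succ, hxa, hxb, hxc, hab, hac, hbc, hxa.symm,
    hxb.symm, hxc.symm, hab.symm, hac.symm, hbc.symm]

theorem exists_perm_apply_eq {α : Type*} {k : ℕ} {p q : Fin k → α} (hp : Function.Injective p)
    (hq : Function.Injective q) : ∃ σ : Equiv.Perm α, ∀ i, σ (p i) = q i := by
  obtain ⟨σ, hσ⟩ := (Equiv.Perm.isMultiplyPretransitive α k).exists_smul_eq ⟨p, hp⟩ ⟨q, hq⟩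
  exact ⟨σ, fun i => DFunLike.congr_fun hσ i⟩

theorem Monotone.eq_of_eq_comp_perm {β : Type*} [PartialOrder β] {v w : Fin d → β}
    (hv : Monotone v) (hw : Monotone w) (σ : Equiv.Perm (Fin d)) (h : w = v ∘ σ) : v = w := by
  subst h
  exact Tuple.unique_monotone (σ := 1) hv hw

theorem sum_pairFamily_indVec_eq_of_monotone {x y n x' y' n' : Fin d} (hxy : x ≠ y) (hxn : x ≠ n)
    (hyn : y ≠ n) (hxy' : x' ≠ y') (hxn' : x' ≠ n') (hyn' : y' ≠ n')
    (h : Monotone (∑ A ∈ pairFamily x y n, indVec A))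
    (h' : Monotone (∑ A ∈ pairFamily x' y' n', indVec A)) :
    ∑ A ∈ pairFamily x y n, indVec A = ∑ A ∈ pairFamily x' y' n', indVec A := by
  obtain ⟨σ, hσ⟩ := exists_perm_apply_eq (injective_vecCons_three hxy' hxn' hyn')
    (injective_vecCons_three hxy hxn hyn)
  have h₁ : σ x' = x := hσ 0
  have h₂ : σ y' = y := hσ 1
  have h₃ : σ n' = n := hσ 2
  refine h.eq_of_eq_comp_perm h' σ ?_
  rw [sum_pairFamily_indVec hxy hxn hyn, sum_pairFamily_indVec hxy' hxn' hyn']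
  ext i
  simp [← h₁, ← h₂, ← h₃]

theorem sum_squareFamily_indVec_eq_of_monotone {x a b x' a' b' : Fin d} (hxa : x ≠ a)
    (hxb : x ≠ b) (hab : a ≠ b) (hxa' : x' ≠ a') (hxb' : x' ≠ b') (hab' : a' ≠ b')
    (h : Monotone (∑ A ∈ squareFamily x a b, indVec A))
    (h' : Monotone (∑ A ∈ squareFamily x' a' b', indVec A)) :
    ∑ A ∈ squareFamily x a b, indVec A = ∑ A ∈ squareFamily x' a' b', indVec A := by
  obtain ⟨σ, hσ⟩ := exists_perm_apply_eq (injective_vecCons_three hxa' hxb' hab')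
    (injective_vecCons_three hxa hxb hab)
  have h₁ : σ x' = x := hσ 0
  have h₂ : σ a' = a := hσ 1
  have h₃ : σ b' = b := hσ 2
  refine h.eq_of_eq_comp_perm h' σ ?_
  rw [sum_squareFamily_indVec hxa hxb hab, sum_squareFamily_indVec hxa' hxb' hab']
  ext i
  simp [← h₁, ← h₂, ← h₃]

theorem sum_starFamily_indVec_eq_of_monotone {x a b c x' a' b' c' : Fin d} (hxa : x ≠ a)
    (hxb : x ≠ b) (hxc : x ≠ c) (hab : a ≠ b) (hac : a ≠ c) (hbc : b ≠ c) (hxa' : x' ≠ a')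
    (hxb' : x' ≠ b') (hxc' : x' ≠ c') (hab' : a' ≠ b') (hac' : a' ≠ c') (hbc' : b' ≠ c')
    (h : Monotone (∑ A ∈ starFamily x a b c, indVec A))
    (h' : Monotone (∑ A ∈ starFamily x' a' b' c', indVec A)) :
    ∑ A ∈ starFamily x a b c, indVec A = ∑ A ∈ starFamily x' a' b' c', indVec A := by
  obtain ⟨σ, hσ⟩ := exists_perm_apply_eq (injective_vecCons_four hxa' hxb' hxc' hab' hac' hbc')
    (injective_vecCons_four hxa hxb hxc hab hac hbc)
  have h₁ : σ x' = x := hσ 0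
  have h₂ : σ a' = a := hσ 1
  have h₃ : σ b' = b := hσ 2
  have h₄ : σ c' = c := hσ 3
  refine h.eq_of_eq_comp_perm h' σ ?_
  rw [sum_starFamily_indVec hxa hxb hxc hab hac hbc,
    sum_starFamily_indVec hxa' hxb' hxc' hab' hac' hbc']
  ext i
  simp [← h₁, ← h₂, ← h₃, ← h₄]

/-- A vertex that is a sum of four generators comes from one of the three explicit families. -/
theorem IsWhaleVertex.exists_eq_sum_family {v : Fin d → ℝ} (hv : IsWhaleVertex d v)
    {S : Set (Fin d → ℝ)} (hS : S ⊆ whaleGens d) (hcard : S.ncard = 4) (hsum : whaleSum S = v) :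
    (∃ x y n, x ≠ y ∧ x ≠ n ∧ y ≠ n ∧ v = ∑ A ∈ pairFamily x y n, indVec A) ∨
    (∃ x a b, x ≠ a ∧ x ≠ b ∧ a ≠ b ∧ v = ∑ A ∈ squareFamily x a b, indVec A) ∨
    (∃ x a b c, x ≠ a ∧ x ≠ b ∧ x ≠ c ∧ a ≠ b ∧ a ≠ c ∧ b ≠ c ∧
      v = ∑ A ∈ starFamily x a b c, indVec A) := by
  obtain ⟨F, h0, rfl⟩ := exists_family_of_subset_whaleGens hS
  rw [Set.ncard_image_of_injective _ indVec_injective, Set.ncard_coe_finset] at hcard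
  rw [whaleSum_image] at hsum
  subst hsum
  rcases eq_family_of_card_eq_four hcard h0 (fun A hA B hB => hv.union_mem h0 hA hB)
    (fun A B => hv.union_notMem h0) with
    ⟨x, y, n, hxy, hxn, hyn, rfl⟩ | ⟨x, a, b, hxa, hxb, hab, rfl⟩ |
    ⟨x, a, b, c, hxa, hxb, hxc, hab, hac, hbc, rfl⟩
  · exact Or.inl ⟨x, y, n, hxy, hxn, hyn, rfl⟩
  · exact Or.inr (Or.inl ⟨x, a, b, hxa, hxb, hab, rfl⟩)
  · exact Or.inr (Or.inr ⟨x, a, b, c, hxa, hxb, hxc, hab, hac, hbc, rfl⟩)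

theorem exists_whaleGens_sum_eq {F : Finset (Finset (Fin d))} {m : ℕ} (h0 : ∅ ∉ F)
    (hm : #F = m) :
    ∃ S : Set (Fin d → ℝ), S ⊆ whaleGens d ∧ S.ncard = m ∧ whaleSum S = ∑ A ∈ F, indVec A :=
  ⟨_, image_subset_whaleGens h0,
    by rw [Set.ncard_image_of_injective _ indVec_injective, Set.ncard_coe_finset, hm],
    whaleSum_image F⟩

end Points

/-- For d ≥ 4, a point with nondecreasing coordinates is a vertex of the White
Whale that is the sum of exactly 4 generators if and only if it is one of
(0,…,0,1,3,3), (0,…,0,2,2,4) and (0,…,0,1,1,1,4). -/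
theorem whale_layer_four (d : ℕ) (hd : 4 ≤ d) (v : Fin d → ℝ) (hv : Monotone v) :
    (IsWhaleVertex d v ∧
      ∃ S : Set (Fin d → ℝ), S ⊆ whaleGens d ∧ S.ncard = 4 ∧ whaleSum S = v) ↔
    ((v = fun i : Fin d =>
        if d - 2 ≤ (i : ℕ) then 3 else if (i : ℕ) = d - 3 then 1 else 0) ∨
     (v = fun i : Fin d =>
        if (i : ℕ) = d - 1 then 4 else if d - 3 ≤ (i : ℕ) then 2 else 0) ∨
     (v = fun i : Fin d =>
        if (i : ℕ) = d - 1 then 4 else if d - 4 ≤ (i : ℕ) then 1 else 0)) := by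
  obtain ⟨k, rfl⟩ : ∃ k, d = k + 4 := ⟨d - 4, by omega⟩
  let p₁ : Fin (k + 4) := ⟨k + 3, by omega⟩
  let p₂ : Fin (k + 4) := ⟨k + 2, by omega⟩
  let p₃ : Fin (k + 4) := ⟨k + 1, by omega⟩
  let p₄ : Fin (k + 4) := ⟨k, by omega⟩
  have h₁₂ : p₁ ≠ p₂ := by simp [p₁, p₂]
  have h₁₃ : p₁ ≠ p₃ := by simp [p₁, p₃]
  have h₁₄ : p₁ ≠ p₄ := by simp [p₁, p₄]
  have h₂₃ : p₂ ≠ p₃ := by simp [p₂, p₃]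
  have h₂₄ : p₂ ≠ p₄ := by simp [p₂, p₄]
  have h₃₄ : p₃ ≠ p₄ := by simp [p₃, p₄]
  have e₁ : (fun i : Fin (k + 4) =>
      if k + 4 - 2 ≤ (i : ℕ) then (3 : ℝ) else if (i : ℕ) = k + 4 - 3 then 1 else 0) =
      ∑ A ∈ pairFamily p₁ p₂ p₃, indVec A := by
    rw [sum_pairFamily_indVec h₁₂ h₁₃ h₂₃]
    ext i
    simp only [p₁, p₂, p₃, Fin.ext_iff]
    split_ifs <;> first | rfl | omega
  have e₂ : (fun i : Fin (k + 4) =>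
      if (i : ℕ) = k + 4 - 1 then (4 : ℝ) else if k + 4 - 3 ≤ (i : ℕ) then 2 else 0) =
      ∑ A ∈ squareFamily p₁ p₂ p₃, indVec A := by
    rw [sum_squareFamily_indVec h₁₂ h₁₃ h₂₃]
    ext i
    simp only [p₁, p₂, p₃, Fin.ext_iff]
    split_ifs <;> first | rfl | omega
  have e₃ : (fun i : Fin (k + 4) =>
      if (i : ℕ) = k + 4 - 1 then (4 : ℝ) else if k + 4 - 4 ≤ (i : ℕ) then 1 else 0) =
      ∑ A ∈ starFamily p₁ p₂ p₃ p₄, indVec A := by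
    rw [sum_starFamily_indVec h₁₂ h₁₃ h₁₄ h₂₃ h₂₄ h₃₄]
    ext i
    simp only [p₁, p₂, p₃, p₄, Fin.ext_iff]
    split_ifs <;> first | rfl | omega
  have m₁ : Monotone (∑ A ∈ pairFamily p₁ p₂ p₃, indVec A) := by
    rw [← e₁]
    intro i j hij
    rw [Fin.le_def] at hij
    dsimp only
    split_ifs <;> first | omega | norm_num
  have m₂ : Monotone (∑ A ∈ squareFamily p₁ p₂ p₃, indVec A) := by
    rw [← e₂]
    intro i j hij
    rw [Fin.le_def] at hij
    dsimp only
    split_ifs <;> first | omega | norm_num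
  have m₃ : Monotone (∑ A ∈ starFamily p₁ p₂ p₃ p₄, indVec A) := by
    rw [← e₃]
    intro i j hij
    rw [Fin.le_def] at hij
    dsimp only
    split_ifs <;> first | omega | norm_num
  rw [e₁, e₂, e₃]
  constructor
  · rintro ⟨hvert, S, hS, hcard, hsum⟩
    rcases hvert.exists_eq_sum_family hS hcard hsum with
      ⟨x, y, n, hxy, hxn, hyn, rfl⟩ | ⟨x, a, b, hxa, hxb, hab, rfl⟩ |
      ⟨x, a, b, c, hxa, hxb, hxc, hab, hac, hbc, rfl⟩
    · exact Or.inl (sum_pairFamily_indVec_eq_of_monotone hxy hxn hyn h₁₂ h₁₃ h₂₃ hv m₁)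
    · exact Or.inr (Or.inl
        (sum_squareFamily_indVec_eq_of_monotone hxa hxb hab h₁₂ h₁₃ h₂₃ hv m₂))
    · exact Or.inr (Or.inr (sum_starFamily_indVec_eq_of_monotone hxa hxb hxc hab hac hbc
        h₁₂ h₁₃ h₁₄ h₂₃ h₂₄ h₃₄ hv m₃))
  · rintro (rfl | rfl | rfl)
    · exact ⟨isWhaleVertex_sum_pairFamily h₁₂ h₁₃ h₂₃,
        exists_whaleGens_sum_eq empty_notMem_pairFamily (card_pairFamily h₁₂ h₁₃ h₂₃)⟩
    · exact ⟨isWhaleVertex_sum_squareFamily h₁₂ h₁₃ h₂₃,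
        exists_whaleGens_sum_eq empty_notMem_squareFamily (card_squareFamily h₁₂ h₁₃ h₂₃)⟩
    · exact ⟨isWhaleVertex_sum_starFamily h₁₂ h₁₃ h₁₄ h₂₃ h₂₄ h₃₄,
        exists_whaleGens_sum_eq empty_notMem_starFamily (card_starFamily h₁₂ h₁₃ h₁₄ h₂₃ h₂₄ h₃₄)⟩
end

section
/- Let S ⊆ G_d with |S| = 2^{d−1} be such that p(S) is a vertex of the White Whale H_∞^+(d,1). Then the set {g ∈ S : p(S \ {g}) is a vertex of H_∞^+(d,1)} equals {𝟏}; in particular the degree from below of p(S) equals 1. -/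
section SubsetSums

open scoped Pointwise

variable {E : Type*} [AddCommGroup E] [Module ℝ E] [DecidableEq E]

/-- The convex hull of the subset sums of a finite set is the set of its combinations with
coefficients in `[0, 1]`. -/
theorem mem_convexHull_subsetSums_iff (G : Finset E) (x : E) :
    x ∈ convexHull ℝ {y : E | ∃ S ⊆ G, y = ∑ g ∈ S, g} ↔
      ∃ m : E → ℝ, (∀ g ∈ G, 0 ≤ m g ∧ m g ≤ 1) ∧ x = ∑ g ∈ G, m g • g := by
  have hsum : {y : E | ∃ S ⊆ G, y = ∑ g ∈ S, g} = ∑ g ∈ G, ({0, g} : Set E) := by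
    ext y
    rw [Set.mem_finsetSum]
    constructor
    · rintro ⟨S, hS, rfl⟩
      refine ⟨fun g => if g ∈ S then g else 0, ?_, ?_⟩
      · intro g _
        by_cases h : g ∈ S <;> simp [h]
      · rw [← Finset.sum_filter, Finset.filter_mem_eq_inter, Finset.inter_eq_right.2 hS]
    · rintro ⟨f, hf, rfl⟩
      refine ⟨G.filter fun g => f g = g, Finset.filter_subset _ _, ?_⟩
      rw [Finset.sum_filter]
      refine Finset.sum_congr rfl fun g hg => ?_
      rcases hf hg with h | h
      · split_ifs with h'
        · exact h'
        · exact h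
      · rw [Set.mem_singleton_iff] at h
        simp [h]
  rw [hsum, convexHull_sum, Set.mem_finsetSum]
  constructor
  · rintro ⟨f, hf, rfl⟩
    have hm : ∀ g, ∃ t : ℝ, g ∈ G → 0 ≤ t ∧ t ≤ 1 ∧ f g = t • g := by
      intro g
      by_cases hg : g ∈ G
      · have h := hf hg
        rw [convexHull_pair, segment_eq_image] at h
        obtain ⟨t, ⟨h0, h1⟩, h⟩ := h
        exact ⟨t, fun _ => ⟨h0, h1, by simpa using h.symm⟩⟩
      · exact ⟨0, fun h => absurd h hg⟩
    choose m hm using hm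
    exact ⟨m, fun g hg => ⟨(hm g hg).1, (hm g hg).2.1⟩,
      Finset.sum_congr rfl fun g hg => (hm g hg).2.2⟩
  · rintro ⟨m, hm, rfl⟩
    refine ⟨fun g => m g • g, ?_, rfl⟩
    intro g hg
    rw [convexHull_pair, segment_eq_image]
    exact ⟨m g, hm g hg, by simp⟩

/-- `S` is separable in `G` if no nontrivial nonnegative combination of `S` equals a nonnegative
combination of `G \ S`. -/
def Separable (G S : Finset E) : Prop :=
  ∀ a : E → ℝ, (∀ g ∈ G, 0 ≤ a g) → ∑ g ∈ S, a g • g = ∑ g ∈ G \ S, a g • g →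
    ∀ g ∈ G, a g = 0

theorem sum_eq_sum_indicator_smul {G S : Finset E} (hS : S ⊆ G) :
    ∑ g ∈ S, g = ∑ g ∈ G, (if g ∈ S then (1 : ℝ) else 0) • g := by
  simp only [ite_smul, one_smul, zero_smul]
  rw [← Finset.sum_filter, Finset.filter_mem_eq_inter, Finset.inter_eq_right.2 hS]

theorem sum_sub_sum_sdiff {G S : Finset E} (hS : S ⊆ G) (a : E → ℝ) :
    ∑ g ∈ S, a g • g - ∑ g ∈ G \ S, a g • g =
      ∑ g ∈ G, (if g ∈ S then a g else -a g) • g := by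
  rw [← Finset.sum_sdiff hS, sub_eq_neg_add, ← Finset.sum_neg_distrib]
  congr 1
  · refine Finset.sum_congr rfl fun g hg => ?_
    simp [(Finset.mem_sdiff.1 hg).2]
  · refine Finset.sum_congr rfl fun g hg => ?_
    simp [hg]

theorem sum_update_add_smul {G : Finset E} {g₀ : E} (hg₀ : g₀ ∈ G) (m : E → ℝ) (δ : ℝ) :
    ∑ g ∈ G, (m g + if g = g₀ then δ else 0) • g = ∑ g ∈ G, m g • g + δ • g₀ := by
  simp [add_smul, Finset.sum_add_distrib, ite_smul, hg₀]

theorem Separable.mem_extremePoints {G S : Finset E} (hS : S ⊆ G) (h : Separable G S) :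
    ∑ g ∈ S, g ∈ Set.extremePoints ℝ (convexHull ℝ {y : E | ∃ T ⊆ G, y = ∑ g ∈ T, g}) := by
  rw [mem_extremePoints_iff_left]
  refine ⟨subset_convexHull _ _ ⟨S, hS, rfl⟩, ?_⟩
  intro x hx y hy hxy
  obtain ⟨a, ha, rfl⟩ := (mem_convexHull_subsetSums_iff G x).1 hx
  obtain ⟨b, hb, rfl⟩ := (mem_convexHull_subsetSums_iff G y).1 hy
  obtain ⟨s, t, hs, ht, hst, hsum⟩ := hxy
  set c : E → ℝ := fun g => if g ∈ S then 1 - (s * a g + t * b g) else s * a g + t * b g with hc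
  have hm0 : ∀ g ∈ G, 0 ≤ s * a g + t * b g := fun g hg =>
    add_nonneg (mul_nonneg hs.le (ha g hg).1) (mul_nonneg ht.le (hb g hg).1)
  have hm1 : ∀ g ∈ G, s * a g + t * b g ≤ 1 := fun g hg => by
    have := mul_le_mul_of_nonneg_left (ha g hg).2 hs.le
    have := mul_le_mul_of_nonneg_left (hb g hg).2 ht.le
    linarith
  have hzero : ∀ g ∈ G, c g = 0 := by
    refine h c (fun g hg => ?_) ?_
    · have := hm0 g hg; have := hm1 g hg
      simp only [hc]; split_ifs <;> linarith
    · rw [← sub_eq_zero, sum_sub_sum_sdiff hS]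
      have : ∀ g ∈ G, (if g ∈ S then c g else -c g) • g =
          (if g ∈ S then (1 : ℝ) else 0) • g - (s • a g • g + t • b g • g) := by
        intro g _
        simp only [hc, smul_smul, ← add_smul, ← sub_smul]
        congr 1
        split_ifs <;> ring
      rw [Finset.sum_congr rfl this, Finset.sum_sub_distrib, ← sum_eq_sum_indicator_smul hS,
        Finset.sum_add_distrib, ← Finset.smul_sum, ← Finset.smul_sum, hsum, sub_self]
  rw [sum_eq_sum_indicator_smul hS]
  refine Finset.sum_congr rfl fun g hg => ?_
  congr 1
  have hz := hzero g hg
  have h1 := ha g hg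
  have h2 := hb g hg
  simp only [hc] at hz
  split_ifs at hz ⊢ with hgS
  · nlinarith
  · nlinarith

theorem separable_of_mem_extremePoints {G S : Finset E} (h0 : (0 : E) ∉ G) (hS : S ⊆ G)
    (h : ∑ g ∈ S, g ∈
      Set.extremePoints ℝ (convexHull ℝ {y : E | ∃ T ⊆ G, y = ∑ g ∈ T, g})) :
    Separable G S := by
  intro a ha hrel g₀ hg₀
  by_contra hne
  have hpos : 0 < a g₀ := lt_of_le_of_ne (ha g₀ hg₀) (Ne.symm hne)
  set M : ℝ := ∑ g ∈ G, a g with hM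
  have hle : ∀ g ∈ G, a g ≤ M := fun g hg => Finset.single_le_sum ha hg
  have hMpos : 0 < M := hpos.trans_le (hle g₀ hg₀)
  have hb0 : ∀ g ∈ G, 0 ≤ a g / M := fun g hg => div_nonneg (ha g hg) hMpos.le
  have hb1 : ∀ g ∈ G, a g / M ≤ 1 := fun g hg => (div_le_one hMpos).2 (hle g hg)
  set δ : ℝ := a g₀ / M with hδ
  have hδ0 : 0 < δ := div_pos hpos hMpos
  set σ : ℝ := if g₀ ∈ S then -1 else 1 with hσ
  have hrel' : ∑ g ∈ G, (if g ∈ S then a g else -a g) • g = 0 := by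
    rw [← sum_sub_sum_sdiff hS, hrel, sub_self]
  set m : E → ℝ := fun g => (if g ∈ S then 1 else 0) - M⁻¹ * (if g ∈ S then a g else -a g) with hm
  have hmsum : ∑ g ∈ G, m g • g = ∑ g ∈ S, g := by
    simp only [hm, sub_smul, Finset.sum_sub_distrib, mul_smul, ← Finset.smul_sum]
    rw [hrel', ← sum_eq_sum_indicator_smul hS, smul_zero, sub_zero]
  have hx : ∑ g ∈ S, g + (σ * δ) • g₀ ∈ convexHull ℝ {y : E | ∃ T ⊆ G, y = ∑ g ∈ T, g} := by
    rw [mem_convexHull_subsetSums_iff, sum_eq_sum_indicator_smul hS]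
    refine ⟨_, fun g hg => ?_, (sum_update_add_smul hg₀ _ _).symm⟩
    have h1 := hb1 g₀ hg₀
    by_cases hgg : g = g₀
    · subst hgg
      by_cases hgS : g ∈ S <;> simp [hσ, hgS] <;> constructor <;> linarith
    · by_cases hgS : g ∈ S <;> simp [hgg, hgS]
  have hy : ∑ g ∈ S, g + (-(σ * δ)) • g₀ ∈ convexHull ℝ {y : E | ∃ T ⊆ G, y = ∑ g ∈ T, g} := by
    rw [mem_convexHull_subsetSums_iff, ← hmsum]
    refine ⟨_, fun g hg => ?_, (sum_update_add_smul hg₀ _ _).symm⟩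
    have h1 := hb1 g hg
    have h2 := hb0 g hg
    rw [div_eq_inv_mul] at h1 h2
    by_cases hgg : g = g₀
    · subst hgg
      rw [div_eq_inv_mul] at hδ
      by_cases hgS : g ∈ S <;> simp [hσ, hm, hgS, hδ]
    · by_cases hgS : g ∈ S <;> simp [hgg, hm, hgS] <;> constructor <;> linarith
  have hmid : ∑ g ∈ S, g ∈
      openSegment ℝ (∑ g ∈ S, g + (σ * δ) • g₀) (∑ g ∈ S, g + (-(σ * δ)) • g₀) := by
    refine ⟨1 / 2, 1 / 2, by norm_num, by norm_num, by norm_num, ?_⟩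
    module
  have heq := ((mem_extremePoints_iff_left).1 h).2 _ hx _ hy hmid
  have hz : (σ * δ) • g₀ = 0 := by simpa using heq
  have hσ0 : σ ≠ 0 := by simp only [hσ]; split_ifs <;> norm_num
  rcases smul_eq_zero.1 hz with h' | h'
  · exact (mul_ne_zero hσ0 hδ0.ne') h'
  · exact h0 (h' ▸ hg₀)

/-- If `g + g' = u`, then a separable set cannot put `g` and `g'` on one side and `u` on the
other. -/
theorem Separable.add_mem {G S : Finset E} (hS : S ⊆ G) (h : Separable G S) {g g' u : E}
    (hg : g ∈ G) (hg' : g' ∈ G) (hu : u ∈ G) (hadd : g + g' = u) :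
    (g ∈ S → g' ∈ S → u ∈ S) ∧ (g ∉ S → g' ∉ S → u ∉ S) := by
  set a : E → ℝ := fun x =>
    (if x = g then 1 else 0) + (if x = g' then 1 else 0) + (if x = u then 1 else 0) with ha
  have hkey : ¬ ∑ x ∈ G, (if x ∈ S then a x else -a x) • x = 0 := by
    intro hrel
    have h1 := h a (fun x _ => by simp only [ha]; positivity)
      (by rw [← sub_eq_zero, sum_sub_sum_sdiff hS, hrel]) u hu
    have h2 : (1 : ℝ) ≤ a u := by
      simp only [ha, if_true]
      have : (0 : ℝ) ≤ (if u = g then 1 else 0) + (if u = g' then 1 else 0) := by positivity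
      linarith
    linarith
  have hexp : ∑ x ∈ G, (if x ∈ S then a x else -a x) • x =
      (if g ∈ S then (1 : ℝ) else -1) • g + (if g' ∈ S then (1 : ℝ) else -1) • g' +
        (if u ∈ S then (1 : ℝ) else -1) • u := by
    have : ∀ x ∈ G, (if x ∈ S then a x else -a x) • x =
        (if x = g then (if x ∈ S then (1 : ℝ) else -1) • x else 0) +
        (if x = g' then (if x ∈ S then (1 : ℝ) else -1) • x else 0) +
        (if x = u then (if x ∈ S then (1 : ℝ) else -1) • x else 0) := by
      intro x _
      simp only [ha]
      split_ifs <;> module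
    rw [Finset.sum_congr rfl this]
    simp only [Finset.sum_add_distrib, Finset.sum_ite_eq', hg, hg', hu, if_true]
  rw [hexp] at hkey
  constructor
  · intro h1 h2
    by_contra h3
    apply hkey
    simp only [h1, h2, h3, if_true, if_false]
    rw [← hadd]
    module
  · intro h1 h2 h3
    apply hkey
    simp only [h1, h2, h3, if_true, if_false]
    rw [← hadd]
    module

/-- Removing `u` from a separable set that contains exactly one of `g` and `u - g` for every
other `g` keeps it separable, provided some linear form is nonnegative on `G`, at most `1` on it,
and equal to `1` at `u`. -/
theorem Separable.erase {G S : Finset E} (hS : S ⊆ G) (h : Separable G S) {u : E} (hu : u ∈ S)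
    (hanti : ∀ g ∈ G, g ≠ u → (u - g ∈ G ∧ u - g ≠ u ∧ (u - g ∈ S ↔ g ∉ S)))
    (φ : E →ₗ[ℝ] ℝ) (hφ0 : ∀ g ∈ G, 0 ≤ φ g) (hφ1 : ∀ g ∈ G, φ g ≤ 1) (hφu : φ u = 1) :
    Separable G (S.erase u) := by
  intro a ha hrel
  have hmemT : ∀ {g}, g ∈ S.erase u → g ∈ G := fun hg => hS (Finset.mem_of_mem_erase hg)
  have hsdiff : G \ S.erase u = insert u (G \ S) := by
    ext x
    simp only [Finset.mem_sdiff, Finset.mem_erase, Finset.mem_insert]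
    have := hS hu
    by_cases hx : x = u
    · subst hx; simp [this]
    · simp [hx]
  have hu' : u ∉ G \ S := by simp [hu]
  rw [hsdiff, Finset.sum_insert hu'] at hrel
  set A : ℝ := ∑ g ∈ S.erase u, a g with hA
  have hbA : a u ≤ A := by
    have h1 := congrArg φ hrel
    simp only [map_add, map_sum, map_smul, smul_eq_mul, hφu, mul_one] at h1
    have h2 : ∑ g ∈ S.erase u, a g * φ g ≤ A := Finset.sum_le_sum fun g hg =>
      mul_le_of_le_one_right (ha g (hmemT hg)) (hφ1 g (hmemT hg))
    have h3 : 0 ≤ ∑ g ∈ G \ S, a g * φ g := Finset.sum_nonneg fun g hg =>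
      mul_nonneg (ha g (Finset.mem_sdiff.1 hg).1) (hφ0 g (Finset.mem_sdiff.1 hg).1)
    linarith
  have hb0 : 0 ≤ a u := ha u (hS hu)
  have hmemD : ∀ {g}, g ∈ G \ S → g ∈ G ∧ g ≠ u ∧ u - g ∈ S.erase u := by
    intro g hg
    have h1 := Finset.mem_sdiff.1 hg
    have hne : g ≠ u := by rintro rfl; exact h1.2 hu
    have h2 := hanti g h1.1 hne
    exact ⟨h1.1, hne, Finset.mem_erase.2 ⟨h2.2.1, h2.2.2.2 h1.2⟩⟩
  have hrefl : ∑ g ∈ G \ S, a (u - g) • g = ∑ g ∈ S.erase u, a g • (u - g) := by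
    refine Finset.sum_bij' (fun g _ => u - g) (fun g _ => u - g) ?_ ?_ ?_ ?_ ?_
    · exact fun g hg => (hmemD hg).2.2
    · intro g hg
      have h1 := hanti g (hmemT hg) (Finset.mem_erase.1 hg).1
      refine Finset.mem_sdiff.2 ⟨h1.1, fun h2 => h1.2.2.1 h2 (Finset.mem_erase.1 hg).2⟩
    · simp
    · simp
    · simp
  -- distribute `a u • u` over the pairs `g + (u - g)`
  have hdist : ∀ r : ℝ, 0 ≤ r → r ≤ 1 → r * A = a u →
      ∀ g ∈ G, (if g = u then 0 else if g ∈ S then a g * (1 - r)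
        else a g + r * a (u - g)) = 0 := by
    intro r hr0 hr1 hrA
    refine h _ ?_ ?_
    · intro g hg
      split_ifs with h1 h2
      · exact le_rfl
      · exact mul_nonneg (ha g hg) (by linarith)
      · exact add_nonneg (ha g hg) (mul_nonneg hr0 (ha _ (hanti g hg h1).1))
    · rw [← Finset.add_sum_erase S _ hu]
      have e1 : ∀ g ∈ S.erase u, (if g = u then 0 else if g ∈ S then a g * (1 - r)
          else a g + r * a (u - g)) • g = a g • g - r • a g • g := by
        intro g hg
        have := Finset.mem_erase.1 hg
        rw [if_neg this.1, if_pos this.2]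
        module
      have e2 : ∀ g ∈ G \ S, (if g = u then 0 else if g ∈ S then a g * (1 - r)
          else a g + r * a (u - g)) • g = a g • g + r • a (u - g) • g := by
        intro g hg
        rw [if_neg (hmemD hg).2.1, if_neg (Finset.mem_sdiff.1 hg).2]
        module
      rw [Finset.sum_congr rfl e1, Finset.sum_congr rfl e2, Finset.sum_sub_distrib,
        Finset.sum_add_distrib, ← Finset.smul_sum, ← Finset.smul_sum, hrefl]
      simp only [smul_sub, Finset.sum_sub_distrib, ← Finset.sum_smul, ← hA, smul_smul, hrA]
      rw [hrel]
      simp only [if_true, zero_smul]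
      module
  have hA0 : A = 0 := by
    by_contra hAne
    have hApos : 0 < A := lt_of_le_of_ne (hb0.trans hbA) (Ne.symm hAne)
    have hd := hdist (a u / A) (div_nonneg hb0 hApos.le) ((div_le_one hApos).2 hbA)
      (div_mul_cancel₀ _ hAne)
    apply hAne
    rw [hA]
    refine Finset.sum_eq_zero fun g hg => ?_
    have hgu := (Finset.mem_erase.1 hg).1
    have hgS := (Finset.mem_erase.1 hg).2
    have h1 := hd g (hS hgS)
    rw [if_neg hgu, if_pos hgS] at h1
    have hr := hanti g (hS hgS) hgu
    have h2 := hd (u - g) hr.1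
    rw [if_neg hr.2.1, if_neg (fun h' => hr.2.2.1 h' hgS), sub_sub_cancel] at h2
    have h3 := ha _ hr.1
    have h4 := ha g (hS hgS)
    have h5 : 0 ≤ a u / A * a g := mul_nonneg (div_nonneg hb0 hApos.le) h4
    linarith
  have hau : a u = 0 := le_antisymm (hA0 ▸ hbA) hb0
  have hd := hdist 0 le_rfl zero_le_one (by simp [hau])
  intro g hg
  by_cases hgu : g = u
  · rw [hgu, hau]
  · simpa [hgu] using hd g hg

end SubsetSums

section Whale

/-- The vertices of the cube `[0, 1]^d`. -/
noncomputable def cubeFinset (d : ℕ) : Finset (Fin d → ℝ) :=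
  Fintype.piFinset fun _ => {0, 1}

theorem mem_cubeFinset {d : ℕ} {g : Fin d → ℝ} :
    g ∈ cubeFinset d ↔ ∀ i, g i = 0 ∨ g i = 1 := by
  simp [cubeFinset]

theorem card_cubeFinset (d : ℕ) : (cubeFinset d).card = 2 ^ d := by
  simp [cubeFinset]

theorem coe_cubeFinset_erase_zero (d : ℕ) :
    (((cubeFinset d).erase 0 : Finset (Fin d → ℝ)) : Set (Fin d → ℝ)) = whaleGens d := by
  ext g
  simp [whaleGens, mem_cubeFinset, and_comm]

theorem one_sub_mem_cubeFinset {d : ℕ} {g : Fin d → ℝ} (hg : g ∈ cubeFinset d) :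
    1 - g ∈ cubeFinset d := by
  rw [mem_cubeFinset] at hg ⊢
  intro i
  rcases hg i with h | h <;> simp [h]

theorem whaleSum_coe {d : ℕ} (S : Finset (Fin d → ℝ)) :
    whaleSum (S : Set (Fin d → ℝ)) = ∑ g ∈ S, g :=
  finsum_mem_coe_finset _ _

theorem whiteWhale_eq (d : ℕ) :
    whiteWhale d = convexHull ℝ {y | ∃ T ⊆ (cubeFinset d).erase 0, y = ∑ g ∈ T, g} := by
  unfold whiteWhale
  congr 1
  ext x
  constructor
  · rintro ⟨S, hS, rfl⟩
    rw [← coe_cubeFinset_erase_zero] at hS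
    obtain ⟨T, rfl⟩ := ((Finset.finite_toSet _).subset hS).exists_finset_coe
    exact ⟨T, by exact_mod_cast hS, whaleSum_coe T⟩
  · rintro ⟨T, hT, rfl⟩
    exact ⟨T, by rw [← coe_cubeFinset_erase_zero]; exact_mod_cast hT, (whaleSum_coe T).symm⟩

theorem isWhaleVertex_iff_separable {d : ℕ} {S : Finset (Fin d → ℝ)}
    (hS : S ⊆ (cubeFinset d).erase 0) :
    IsWhaleVertex d (whaleSum (S : Set (Fin d → ℝ))) ↔ Separable ((cubeFinset d).erase 0) S := by
  rw [IsWhaleVertex, whiteWhale_eq, whaleSum_coe]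
  exact ⟨separable_of_mem_extremePoints (by simp) hS, fun h => h.mem_extremePoints hS⟩

theorem one_mem_of_separable {d : ℕ} (hd : 1 ≤ d) {S : Finset (Fin d → ℝ)}
    (hS : S ⊆ (cubeFinset d).erase 0) (hcard : S.card = 2 ^ (d - 1))
    (h : Separable ((cubeFinset d).erase 0) S) : (1 : Fin d → ℝ) ∈ S := by
  by_contra h1
  have h1cube : (1 : Fin d → ℝ) ∈ cubeFinset d := by simp [mem_cubeFinset]
  have hne : (1 : Fin d → ℝ) ≠ 0 := fun h' => by simpa using congrFun h' ⟨0, hd⟩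
  have hdisj : Disjoint S (S.image fun g => 1 - g) := by
    rw [Finset.disjoint_left]
    rintro g hg hg'
    obtain ⟨g', hg'S, rfl⟩ := Finset.mem_image.1 hg'
    exact h1 ((h.add_mem hS (hS hg) (hS hg'S)
      (Finset.mem_erase.2 ⟨hne, h1cube⟩) (by simp)).1 hg hg'S)
  have hsub : S ∪ (S.image fun g => 1 - g) ⊆ (cubeFinset d).erase 1 := by
    intro g hg
    rcases Finset.mem_union.1 hg with hg | hg
    · exact Finset.mem_erase.2 ⟨fun h' => h1 (h' ▸ hg), (Finset.mem_erase.1 (hS hg)).2⟩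
    · obtain ⟨g', hg', rfl⟩ := Finset.mem_image.1 hg
      have := Finset.mem_erase.1 (hS hg')
      exact Finset.mem_erase.2 ⟨by simpa using this.1, one_sub_mem_cubeFinset this.2⟩
  have hle := Finset.card_le_card hsub
  rw [Finset.card_union_of_disjoint hdisj, Finset.card_image_of_injective _ sub_right_injective,
    hcard, Finset.card_erase_of_mem h1cube, card_cubeFinset] at hle
  obtain ⟨n, rfl⟩ : ∃ n, d = n + 1 := ⟨d - 1, by omega⟩
  have : 0 < 2 ^ n := by positivity
  rw [Nat.add_sub_cancel, pow_succ] at hle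
  omega

theorem one_sub_mem_iff_of_separable {d : ℕ} (hd : 1 ≤ d) {S : Finset (Fin d → ℝ)}
    (hS : S ⊆ (cubeFinset d).erase 0) (hcard : S.card = 2 ^ (d - 1))
    (h : Separable ((cubeFinset d).erase 0) S) {g : Fin d → ℝ}
    (hg : g ∈ (cubeFinset d).erase 0) (hg1 : g ≠ 1) : 1 - g ∈ S ↔ g ∉ S := by
  have h1 := one_mem_of_separable hd hS hcard h
  have hanti : ∀ x ∈ (cubeFinset d).erase 0, x ≠ 1 → x ∉ S → 1 - x ∈ S := by
    intro x hx hx1 hxS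
    by_contra hxS'
    exact (h.add_mem hS hx (Finset.mem_erase.2 ⟨sub_ne_zero.2 hx1.symm,
      one_sub_mem_cubeFinset (Finset.mem_erase.1 hx).2⟩) (hS h1) (by simp)).2 hxS hxS' h1
  refine ⟨fun hg' hgS => ?_, hanti g hg hg1⟩
  have hsub : cubeFinset d ⊆ S ∪ (S.image fun g => 1 - g) := by
    intro x hx
    by_cases hxS : x ∈ S
    · exact Finset.mem_union_left _ hxS
    refine Finset.mem_union_right _ (Finset.mem_image.2 ⟨1 - x, ?_, by simp⟩)
    by_cases hx0 : x = 0
    · simpa [hx0] using h1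
    · exact hanti x (Finset.mem_erase.2 ⟨hx0, hx⟩) (fun h' => hxS (h' ▸ h1)) hxS
  have hle := Finset.card_le_card hsub
  have hinter : 0 < (S ∩ S.image fun g => 1 - g).card :=
    Finset.card_pos.2 ⟨g, Finset.mem_inter.2 ⟨hgS, Finset.mem_image.2 ⟨1 - g, hg', by simp⟩⟩⟩
  have hadd := Finset.card_union_add_card_inter S (S.image fun g => 1 - g)
  rw [Finset.card_image_of_injective _ sub_right_injective, hcard] at hadd
  rw [card_cubeFinset] at hle
  obtain ⟨n, rfl⟩ : ∃ n, d = n + 1 := ⟨d - 1, by omega⟩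
  rw [Nat.add_sub_cancel] at hadd
  rw [pow_succ] at hle
  omega

end Whale

/-- If |S| = 2^(d−1) and p(S) is a vertex of the White Whale, then the set of
g ∈ S such that p(S \ {g}) is a vertex is exactly {𝟏}; in particular the
degree from below of p(S) equals 1. -/
theorem whale_degree_below_middle (d : ℕ) (hd : 1 ≤ d)
    (S : Set (Fin d → ℝ)) (hS : S ⊆ whaleGens d)
    (hcard : S.ncard = 2 ^ (d - 1))
    (hv : IsWhaleVertex d (whaleSum S)) :
    {g ∈ S | IsWhaleVertex d (whaleSum (S \ {g}))} =
      {fun _ : Fin d => (1 : ℝ)} := by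
  rw [← coe_cubeFinset_erase_zero] at hS
  obtain ⟨S, rfl⟩ := ((Finset.finite_toSet _).subset hS).exists_finset_coe
  have hS : S ⊆ (cubeFinset d).erase 0 := by exact_mod_cast hS
  rw [Set.ncard_coe_finset] at hcard
  rw [isWhaleVertex_iff_separable hS] at hv
  have h1 := one_mem_of_separable hd hS hcard hv
  have hanti := fun {g} => one_sub_mem_iff_of_separable hd hS hcard hv (g := g)
  have hcompl : ∀ g ∈ (cubeFinset d).erase 0, g ≠ 1 → 1 - g ∈ (cubeFinset d).erase 0 :=
    fun g hg hg1 => Finset.mem_erase.2 ⟨sub_ne_zero.2 hg1.symm,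
      one_sub_mem_cubeFinset (Finset.mem_erase.1 hg).2⟩
  have herase : ∀ g, IsWhaleVertex d (whaleSum ((S : Set (Fin d → ℝ)) \ {g})) ↔
      Separable ((cubeFinset d).erase 0) (S.erase g) := fun g => by
    rw [← Finset.coe_erase, isWhaleVertex_iff_separable ((Finset.erase_subset _ _).trans hS)]
  change _ = {(1 : Fin d → ℝ)}
  ext g
  simp only [Set.mem_ofPred_eq, Finset.mem_coe, Set.mem_singleton_iff, herase]
  constructor
  · rintro ⟨hg, hsep⟩
    by_contra hg1
    refine (hsep.add_mem ((Finset.erase_subset _ _).trans hS) (hS hg) (hcompl g (hS hg) hg1)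
      (hS h1) (by simp)).2 (by simp) ?_ (Finset.mem_erase.2 ⟨Ne.symm hg1, h1⟩)
    exact fun h' => (hanti (hS hg) hg1).1 (Finset.mem_of_mem_erase h') hg
  · rintro rfl
    refine ⟨h1, hv.erase hS h1 (fun g hg hg1 => ⟨hcompl g hg hg1, ?_, hanti hg hg1⟩)
      (LinearMap.proj ⟨0, hd⟩) ?_ ?_ rfl⟩
    · simpa using (Finset.mem_erase.1 hg).1
    · intro g hg
      rcases mem_cubeFinset.1 (Finset.mem_erase.1 hg).2 ⟨0, hd⟩ with h | h <;> simp [h]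
    · intro g hg
      rcases mem_cubeFinset.1 (Finset.mem_erase.1 hg).2 ⟨0, hd⟩ with h | h <;> simp [h]
end

section
/- Let S ⊆ G_d with |S| = 2^{d−1} − 1 be such that p(S) is a vertex of the White Whale H_∞^+(d,1). Then there is exactly one vector g ∈ G_d \ S such that p(S ∪ {g}) is a vertex of H_∞^+(d,1); that is, the degree from above of p(S) equals 1. -/
theorem whaleGens_eq_piFinset_sdiff (d : ℕ) :
    whaleGens d = ((Fintype.piFinset fun _ : Fin d => ({0, 1} : Finset ℝ)) \ {0} :
      Finset (Fin d → ℝ)) := by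
  ext g
  simp [whaleGens, and_comm]

theorem finite_whaleGens (d : ℕ) : (whaleGens d).Finite := by
  rw [whaleGens_eq_piFinset_sdiff]
  exact Finset.finite_toSet _

theorem ncard_whaleGens (d : ℕ) : (whaleGens d).ncard = 2 ^ d - 1 := by
  rw [whaleGens_eq_piFinset_sdiff, Set.ncard_coe_finset, Finset.card_sdiff_of_subset (by simp)]
  simp

theorem one_mem_whaleGens {d : ℕ} (hd : 1 ≤ d) : (1 : Fin d → ℝ) ∈ whaleGens d :=
  ⟨fun h => one_ne_zero (congrFun h ⟨0, hd⟩), fun _ => Or.inr rfl⟩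

theorem one_sub_mem_whaleGens {d : ℕ} {g : Fin d → ℝ} (hg : g ∈ whaleGens d) (h1 : g ≠ 1) :
    1 - g ∈ whaleGens d := by
  refine ⟨fun h => h1 (sub_eq_zero.1 h).symm, fun i => ?_⟩
  rcases hg.2 i with h | h <;> simp [h]

theorem whaleSum_insert {d : ℕ} {S : Set (Fin d → ℝ)} (hS : S.Finite) {g : Fin d → ℝ}
    (hg : g ∉ S) : whaleSum (insert g S) = g + whaleSum S :=
  finsum_mem_insert _ hg hS

theorem finite_setOf_whaleSum (d : ℕ) :
    {x | ∃ S : Set (Fin d → ℝ), S ⊆ whaleGens d ∧ x = whaleSum S}.Finite := by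
  refine ((finite_whaleGens d).finite_subsets.image whaleSum).subset ?_
  rintro _ ⟨S, hS, rfl⟩
  exact ⟨S, hS, rfl⟩

theorem whaleSum_mem_whiteWhale {d : ℕ} {S : Set (Fin d → ℝ)} (hS : S ⊆ whaleGens d) :
    whaleSum S ∈ whiteWhale d :=
  subset_convexHull _ _ ⟨S, hS, rfl⟩

/-- A vertex of the White Whale strictly separates the generators it uses from the others. -/
theorem IsWhaleVertex.exists_separating {d : ℕ} {S : Set (Fin d → ℝ)} (hS : S ⊆ whaleGens d)
    (hv : IsWhaleVertex d (whaleSum S)) :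
    ∃ f : (Fin d → ℝ) →ₗ[ℝ] ℝ, (∀ g ∈ S, 0 < f g) ∧ ∀ g ∈ whaleGens d, g ∉ S → f g < 0 := by
  set P := {x | ∃ S : Set (Fin d → ℝ), S ⊆ whaleGens d ∧ x = whaleSum S}
  have hSfin := (finite_whaleGens d).subset hS
  have hx : whaleSum S ∉ convexHull ℝ (P \ {whaleSum S}) := fun h =>
    (((convex_convexHull ℝ P).mem_extremePoints_iff_mem_sdiff_convexHull_sdiff).1 hv).2
      (convexHull_mono (Set.sdiff_subset_sdiff_left (subset_convexHull ℝ P)) h)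
  obtain ⟨f, u, hfu, hux⟩ := geometric_hahn_banach_closed_point (convex_convexHull ℝ _)
    (((finite_setOf_whaleSum d).subset Set.sdiff_subset).isClosed_convexHull ℝ) hx
  have key : ∀ T ⊆ whaleGens d, whaleSum T ≠ whaleSum S → f (whaleSum T) < f (whaleSum S) :=
    fun T hT hne => (hfu _ (subset_convexHull ℝ _ ⟨⟨T, hT, rfl⟩, hne⟩)).trans hux
  refine ⟨f.toLinearMap, fun g hg => ?_, fun g hg hgS => ?_⟩
  · have hsum : whaleSum S = g + whaleSum (S \ {g}) := by
      rw [← whaleSum_insert (hSfin.subset Set.sdiff_subset) (by simp), Set.insert_sdiff_singleton,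
        Set.insert_eq_of_mem hg]
    have := key (S \ {g}) (Set.sdiff_subset.trans hS) (by
      rw [hsum]
      simpa using (hS hg).1)
    rw [hsum, map_add] at this
    simpa using this
  · have hsum := whaleSum_insert hSfin hgS
    have := key (insert g S) (Set.insert_subset hg hS) (by
      rw [hsum]
      simpa using hg.1)
    rw [hsum, map_add] at this
    simpa using this

theorem map_whaleSum_eq_sum {d : ℕ} (f : (Fin d → ℝ) →ₗ[ℝ] ℝ) {S : Set (Fin d → ℝ)}
    (hS : S ⊆ whaleGens d) :
    f (whaleSum S) = ∑ g ∈ (finite_whaleGens d).toFinset, S.indicator f g := by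
  have hSfin := (finite_whaleGens d).subset hS
  rw [whaleSum, ← LinearMap.toAddMonoidHom_coe, AddMonoidHom.map_finsum_mem _ _ hSfin,
    finsum_mem_def]
  refine finsum_eq_sum_of_support_subset _ fun g hg => ?_
  simpa using hS (Set.support_indicator_subset hg)

/-- A functional that strictly separates `S` from the other generators certifies a vertex. -/
theorem isWhaleVertex_of_separating {d : ℕ} {S : Set (Fin d → ℝ)} (hS : S ⊆ whaleGens d)
    (f : (Fin d → ℝ) →ₗ[ℝ] ℝ) (hpos : ∀ g ∈ S, 0 < f g)
    (hneg : ∀ g ∈ whaleGens d, g ∉ S → f g < 0) : IsWhaleVertex d (whaleSum S) := by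
  have key : ∀ T ⊆ whaleGens d, T ≠ S → f (whaleSum T) < f (whaleSum S) := by
    intro T hT hne
    rw [map_whaleSum_eq_sum f hT, map_whaleSum_eq_sum f hS]
    have hlt : ∀ g ∈ whaleGens d, ¬ (g ∈ T ↔ g ∈ S) → T.indicator f g < S.indicator f g := by
      intro g hg hiff
      by_cases hgS : g ∈ S
      · have hgT : g ∉ T := by tauto
        simpa [hgS, hgT] using hpos g hgS
      · have hgT : g ∈ T := by tauto
        simpa [hgS, hgT] using hneg g hg hgS
    refine Finset.sum_lt_sum (fun g hg => ?_) ?_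
    · by_cases hiff : g ∈ T ↔ g ∈ S
      · by_cases hgS : g ∈ S <;> simp [hiff, hgS]
      · exact (hlt g (by simpa using hg) hiff).le
    · obtain ⟨g, hg⟩ : ∃ g, ¬ (g ∈ T ↔ g ∈ S) := by
        by_contra! h
        exact hne (Set.ext h)
      have hgG : g ∈ whaleGens d := by
        by_contra hgG
        exact hg ⟨fun h => absurd (hT h) hgG, fun h => absurd (hS h) hgG⟩
      exact ⟨g, by simpa using hgG, hlt g hgG hg⟩
  have hsub : whiteWhale d ⊆ {y | y = whaleSum S ∨ f y < f (whaleSum S)} := by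
    refine convexHull_min ?_ ?_
    · rintro _ ⟨T, hT, rfl⟩
      by_cases h : T = S
      · exact Or.inl (h ▸ rfl)
      · exact Or.inr (key T hT h)
    · refine convex_iff_forall_pos.2 ?_
      rintro y hy z hz a b ha hb hab
      by_cases h : y = whaleSum S ∧ z = whaleSum S
      · left
        rw [h.1, h.2, ← add_smul, hab, one_smul]
      · right
        have hb' : b = 1 - a := by linarith
        subst hb'
        simp only [map_add, map_smul, smul_eq_mul]
        rcases hy with rfl | hy <;> rcases hz with rfl | hz
        · simp at h
        all_goals nlinarith
  refine mem_extremePoints.2 ⟨whaleSum_mem_whiteWhale hS, fun y hy z hz hyz => ?_⟩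
  obtain ⟨a, b, ha, hb, hab, hx⟩ := hyz
  have hfx := congrArg f hx
  have hb' : b = 1 - a := by linarith
  subst hb'
  simp only [map_add, map_smul, smul_eq_mul] at hfx
  rcases hsub hy with hy | hy <;> rcases hsub hz with hz | hz
  · exact ⟨hy, hz⟩
  · subst hy
    nlinarith
  · subst hz
    nlinarith
  · nlinarith

/-- A vertex using one generator fewer than half of `2 ^ d` omits the all-ones vector, and uses
one generator out of every other complementary pair. -/
theorem one_notMem_and_one_sub_mem {d : ℕ} (hd : 1 ≤ d) {S : Set (Fin d → ℝ)}
    (hS : S ⊆ whaleGens d) (hcard : S.ncard = 2 ^ (d - 1) - 1) {f : (Fin d → ℝ) →ₗ[ℝ] ℝ}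
    (hpos : ∀ g ∈ S, 0 < f g) (hneg : ∀ g ∈ whaleGens d, g ∉ S → f g < 0) :
    (1 : Fin d → ℝ) ∉ S ∧ ∀ g ∈ whaleGens d, g ∉ S → g ≠ 1 → 1 - g ∈ S := by
  have hfin := finite_whaleGens d
  have hinj : Function.Injective fun g : Fin d → ℝ => 1 - g := sub_right_injective
  have hpow : 2 ^ d = 2 * 2 ^ (d - 1) := by
    rw [← pow_succ', Nat.sub_add_cancel hd]
  have hpow_pos : 0 < 2 ^ (d - 1) := by positivity
  have hN : (whaleGens d \ S).ncard = 2 ^ (d - 1) := by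
    rw [Set.ncard_sdiff hS (hfin.subset hS), ncard_whaleGens, hcard]
    omega
  have h1 : (1 : Fin d → ℝ) ∉ S := by
    intro h1
    have hle : (whaleGens d \ S).ncard ≤ S.ncard := by
      refine Set.ncard_le_ncard_of_injOn (fun g => 1 - g) ?_ hinj.injOn (hfin.subset hS)
      rintro g ⟨hg, hgS⟩
      by_contra hc
      have h := hneg _ (one_sub_mem_whaleGens hg (fun h => hgS (h ▸ h1))) hc
      rw [map_sub] at h
      linarith [hpos 1 h1, hneg g hg hgS]
    omega
  refine ⟨h1, fun g hg hgS hg1 => ?_⟩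
  have h1G := one_mem_whaleGens hd
  have hsub : (fun g => 1 - g) '' S ⊆ (whaleGens d \ S) \ {1} := by
    rintro _ ⟨g, hg, rfl⟩
    refine ⟨⟨one_sub_mem_whaleGens (hS hg) (fun h => h1 (h ▸ hg)), fun hc => ?_⟩, ?_⟩
    · have h := hpos _ hc
      rw [map_sub] at h
      linarith [hneg 1 h1G h1, hpos g hg]
    · simpa using (hS hg).1
  have h1N : (1 : Fin d → ℝ) ∈ whaleGens d \ S := ⟨h1G, h1⟩
  have heq := Set.eq_of_subset_of_ncard_le hsub (by
    rw [Set.ncard_image_of_injective _ hinj, Set.ncard_sdiff_singleton_of_mem h1N, hN, hcard])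
    ((hfin.subset Set.sdiff_subset).subset Set.sdiff_subset)
  obtain ⟨h, hh, rfl⟩ : g ∈ (fun g => 1 - g) '' S := heq ▸ ⟨⟨hg, hgS⟩, hg1⟩
  simpa using hh

/-- The functional separating `S` can be tilted along a coordinate so that the all-ones vector
joins `S`. -/
theorem isWhaleVertex_insert_one {d : ℕ} (hd : 1 ≤ d) {S : Set (Fin d → ℝ)}
    (hS : S ⊆ whaleGens d) {f : (Fin d → ℝ) →ₗ[ℝ] ℝ}
    (hpos : ∀ g ∈ S, 0 < f g) (hneg : ∀ g ∈ whaleGens d, g ∉ S → f g < 0)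
    (h1 : (1 : Fin d → ℝ) ∉ S) (hcompl : ∀ g ∈ whaleGens d, g ∉ S → g ≠ 1 → 1 - g ∈ S) :
    IsWhaleVertex d (whaleSum (insert 1 S)) := by
  have h1G := one_mem_whaleGens hd
  have hf1 := hneg 1 h1G h1
  have hgap : ∀ g ∈ whaleGens d \ insert 1 S, f g < f 1 := by
    rintro g ⟨hg, hgS⟩
    rw [Set.mem_insert_iff, not_or] at hgS
    have h := hpos _ (hcompl g hg hgS.2 hgS.1)
    rw [map_sub] at h
    linarith
  obtain ⟨ε, hε, hεpos⟩ : ∃ ε : ℝ, (∀ g ∈ whaleGens d \ insert 1 S, ε < f 1 - f g) ∧ 0 < ε := by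
    have h : ∀ᶠ ε in nhdsWithin (0 : ℝ) (Set.Ioi 0),
        ∀ g ∈ whaleGens d \ insert 1 S, ε < f 1 - f g :=
      (Filter.eventually_all_finite ((finite_whaleGens d).subset Set.sdiff_subset)).2 fun g hg =>
        nhdsWithin_le_nhds (eventually_lt_nhds (sub_pos.2 (hgap g hg)))
    exact (h.and self_mem_nhdsWithin).exists
  refine isWhaleVertex_of_separating (Set.insert_subset h1G hS)
    (f + (ε - f 1) • LinearMap.proj (⟨0, hd⟩ : Fin d)) ?_ ?_
  · rintro g (rfl | hg)
    · simpa using hεpos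
    · have h := hpos g hg
      rcases (hS hg).2 ⟨0, hd⟩ with h0 | h0 <;> simp [h0] <;> linarith
  · intro g hg hgS
    have h := hε g ⟨hg, hgS⟩
    have h' := hgap g ⟨hg, hgS⟩
    rcases hg.2 ⟨0, hd⟩ with h0 | h0 <;> simp [h0] <;> linarith

/-- If |S| = 2^(d−1) − 1 and p(S) is a vertex of the White Whale, then there
is exactly one g ∈ G_d \ S such that p(S ∪ {g}) is a vertex: the degree from
above of p(S) equals 1. -/
theorem whale_degree_above_middle (d : ℕ) (hd : 1 ≤ d)
    (S : Set (Fin d → ℝ)) (hS : S ⊆ whaleGens d)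
    (hcard : S.ncard = 2 ^ (d - 1) - 1)
    (hv : IsWhaleVertex d (whaleSum S)) :
    {g | g ∈ whaleGens d ∧ g ∉ S ∧
      IsWhaleVertex d (whaleSum (S ∪ {g}))}.ncard = 1 := by
  obtain ⟨f, hpos, hneg⟩ := hv.exists_separating hS
  obtain ⟨h1, hcompl⟩ := one_notMem_and_one_sub_mem hd hS hcard hpos hneg
  have h1G := one_mem_whaleGens hd
  rw [Set.ncard_eq_one]
  refine ⟨1, Set.eq_singleton_iff_unique_mem.2 ⟨⟨h1G, h1, ?_⟩, ?_⟩⟩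
  · rw [Set.union_singleton]
    exact isWhaleVertex_insert_one hd hS hpos hneg h1 hcompl
  · rintro g ⟨hg, hgS, hgv⟩
    by_contra hg1
    obtain ⟨f', hpos', hneg'⟩ :=
      hgv.exists_separating (Set.union_subset hS (Set.singleton_subset_iff.2 hg))
    have hsub := hpos' (1 - g) (Or.inl (hcompl g hg hgS hg1))
    rw [map_sub] at hsub
    have hone : (1 : Fin d → ℝ) ∉ S ∪ {g} := by
      rintro (h | h)
      · exact h1 h
      · exact hg1 h.symm
    linarith [hpos' g (Or.inr rfl), hneg' 1 h1G hone]
end
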